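/- The vector (2, 2, 2, 1) is uniquely realized by the graph H_7: H_7 is a cop-win graph with rank cardinality vector (2, 2, 2, 1), and every cop-win graph whose rank cardinality vector is (2, 2, 2, 1) is isomorphic to H_7. -/

import Mathlib

namespace CopsRobbers

variable {V : Type*}

/-- The closed neighborhood of `v` within the vertex set `S` (graphs are reflexive,
so `v` itself belongs to its closed neighborhood). -/
def closedNbhd (G : SimpleGraph V) (S : Set V) (v : V) : Set V :=
  {u | u ∈ S ∧ (u = v ∨ G.Adj u v)}

/-- `v` is a strict corner of the subgraph induced on `S`: some other vertex `w ∈ S`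
strictly corners `v`, i.e. `N[v] ⊊ N[w]` within `S`. -/
def StrictCorner (G : SimpleGraph V) (S : Set V) (v : V) : Prop :=
  v ∈ S ∧ ∃ w ∈ S, w ≠ v ∧ closedNbhd G S v ⊂ closedNbhd G S w

/-- The remaining vertex sets of the corner ranking procedure (0-indexed auxiliary
version): at each step all current strict corners are removed. -/
def stageAux (G : SimpleGraph V) : ℕ → Set V
  | 0 => Set.univ
  | n + 1 => stageAux G n \ {v | StrictCorner G (stageAux G n) v}

/-- `stage G k` is the vertex set of `G^(k)` (for `k ≥ 1`), so `stage G 1 = V(G)`. -/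
def stage (G : SimpleGraph V) (k : ℕ) : Set V := stageAux G (k - 1)

/-- The corner rank of a vertex: the least `k ≥ 1` such that `v` is a strict corner
of `G^(k)`, or `G^(k)` is a clique still containing `v`; and `⊤` (that is, `∞`) if
there is no such `k`. -/
noncomputable def cornerRank (G : SimpleGraph V) (v : V) : ℕ∞ :=
  sInf {k : ℕ∞ | ∃ n : ℕ, k = (n : ℕ∞) ∧ 1 ≤ n ∧
    (StrictCorner G (stage G n) v ∨ (G.IsClique (stage G n) ∧ v ∈ stage G n))}

/-- The corner rank of a graph: the largest corner rank of a vertex. -/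
noncomputable def graphRank (G : SimpleGraph V) : ℕ∞ := ⨆ v, cornerRank G v

/-- A graph is cop-win iff every vertex has finite corner rank. -/
def CopWin (G : SimpleGraph V) : Prop := ∀ v, cornerRank G v ≠ ⊤

/-- `v` dominates the set `S`: `v` is (reflexively) adjacent to every vertex of `S`. -/
def Dominates (G : SimpleGraph V) (v : V) (S : Set V) : Prop :=
  ∀ u ∈ S, u = v ∨ G.Adj v u

/-- A cop-win graph of corner rank `α ≥ 2` is `tp1` if some vertex of corner rank `α`
dominates the vertex set of `G^(α-1)`. -/
def Tp1 (G : SimpleGraph V) : Prop :=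
  ∃ α : ℕ, 2 ≤ α ∧ graphRank G = (α : ℕ∞) ∧
    ∃ v, cornerRank G v = (α : ℕ∞) ∧ Dominates G v (stage G (α - 1))

/-- `G` realizes the vector `(x_α, …, x_1)` (written as the list `[x_α, …, x_1]`):
`G` is cop-win of corner rank `α` and for each `k`, `x_k` is the number of vertices
of corner rank `k`. -/
def Realizes (G : SimpleGraph V) (x : List ℕ) : Prop :=
  CopWin G ∧ graphRank G = (x.length : ℕ∞) ∧
  ∀ i : Fin x.length,
    x.get i = {v | cornerRank G v = ((x.length - (i : ℕ) : ℕ) : ℕ∞)}.ncard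

/-- `G` r-realizes `x` (for `r ∈ {0,1}`): `G` realizes `x` and `G` is tp-r. -/
def RRealizes (G : SimpleGraph V) (r : ℕ) (x : List ℕ) : Prop :=
  Realizes G x ∧ (Tp1 G ↔ r = 1)

/-- A vector is realizable if it is the rank cardinality vector of some finite cop-win graph. -/
def Realizable (x : List ℕ) : Prop :=
  ∃ (W : Type) (_ : Fintype W) (G : SimpleGraph W), Realizes G x

/-- A vector is r-realizable if some finite tp-r cop-win graph realizes it. -/
def RRealizable (r : ℕ) (x : List ℕ) : Prop :=
  ∃ (W : Type) (_ : Fintype W) (G : SimpleGraph W), RRealizes G r x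

open Classical in
/-- The capture time of a cop-win graph: `cr(G) - r(G)`. -/
noncomputable def captureTime (G : SimpleGraph V) : ℕ :=
  (graphRank G).toNat - (if Tp1 G then 1 else 0)

end CopsRobbers
namespace CopsRobbers

/-- The graph `H₇` with vertices `a₁=0, a₂=1, b₁=2, b₂=3, c₁=4, c₂=5, d=6` and edge set
`{a₁a₂, a₁b₁, a₁b₂, a₂b₁, a₂b₂, a₂c₁, a₁c₂, b₁c₁, b₁c₂, b₁d, b₂c₁, b₂c₂, c₁d, c₂d}`. -/
def H7 : SimpleGraph (Fin 7) :=
  SimpleGraph.fromRel (fun u v =>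
    ((u, v) : Fin 7 × Fin 7) ∈
      ([(0, 1), (0, 2), (0, 3), (1, 2), (1, 3), (1, 4), (0, 5),
        (2, 4), (2, 5), (2, 6), (3, 4), (3, 5), (4, 6), (5, 6)] :
        List (Fin 7 × Fin 7)))

variable {V : Type*}

theorem strictCorner_iff {G : SimpleGraph V} {S : Set V} {v : V} :
    StrictCorner G S v ↔ v ∈ S ∧ ∃ w ∈ S, w ≠ v ∧
      (∀ u ∈ S, (u = v ∨ G.Adj u v) → (u = w ∨ G.Adj u w)) ∧
      ∃ u ∈ S, (u = w ∨ G.Adj u w) ∧ ¬ (u = v ∨ G.Adj u v) := by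
  unfold StrictCorner
  simp only [Set.ssubset_iff_exists, Set.subset_def, closedNbhd, Set.mem_ofPred_eq]
  grind

theorem strictCorner_preimage {W : Type*} (G : SimpleGraph W) (e : V ≃ W) (S : Set W) (v : V) :
    StrictCorner (G.comap e) (e ⁻¹' S) v ↔ StrictCorner G S (e v) := by
  simp only [strictCorner_iff, e.surjective.exists, e.surjective.forall, Set.mem_preimage,
    SimpleGraph.comap_adj, ne_eq, e.injective.eq_iff]

theorem stageAux_antitone (G : SimpleGraph V) : Antitone (stageAux G) :=
  antitone_nat_of_succ_le fun _ => Set.sdiff_subset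

theorem cornerRank_le_of_strictCorner {G : SimpleGraph V} {k : ℕ} {v : V}
    (h : StrictCorner G (stageAux G k) v) : cornerRank G v ≤ (k + 1 : ℕ) :=
  sInf_le ⟨k + 1, rfl, by omega, Or.inl h⟩

theorem cornerRank_le_of_isClique {G : SimpleGraph V} {k : ℕ} {v : V}
    (h : G.IsClique (stageAux G k)) (hv : v ∈ stageAux G k) : cornerRank G v ≤ (k + 1 : ℕ) :=
  sInf_le ⟨k + 1, rfl, by omega, Or.inr ⟨h, hv⟩⟩

theorem cornerRank_le_of_notMem_stageAux {G : SimpleGraph V} {k : ℕ} {v : V}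
    (h : v ∉ stageAux G k) : cornerRank G v ≤ k := by
  induction k with
  | zero => exact absurd (Set.mem_univ v) h
  | succ k ih =>
    by_cases hv : v ∈ stageAux G k
    · refine cornerRank_le_of_strictCorner ?_
      by_contra hc
      exact h ⟨hv, hc⟩
    · exact (ih hv).trans (by exact_mod_cast Nat.le_succ k)

theorem exists_of_cornerRank_ne_top {G : SimpleGraph V} {v : V} (h : cornerRank G v ≠ ⊤) :
    ∃ k : ℕ, cornerRank G v = (k + 1 : ℕ) ∧ (StrictCorner G (stageAux G k) v ∨
      (G.IsClique (stageAux G k) ∧ v ∈ stageAux G k)) := by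
  have hne : {k : ℕ∞ | ∃ n : ℕ, k = (n : ℕ∞) ∧ 1 ≤ n ∧
      (StrictCorner G (stage G n) v ∨ (G.IsClique (stage G n) ∧ v ∈ stage G n))}.Nonempty := by
    by_contra hc
    rw [Set.not_nonempty_iff_eq_empty] at hc
    exact h (by rw [cornerRank, hc, sInf_empty])
  obtain ⟨n, hn, hpos, hP⟩ := csInf_mem hne
  obtain ⟨k, rfl⟩ := Nat.exists_eq_add_of_le' hpos
  exact ⟨k, hn, hP⟩

theorem lt_cornerRank_of_mem_stageAux {G : SimpleGraph V} {k : ℕ} {v : V}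
    (hv : v ∈ stageAux G k) (hk : ∀ j < k, ¬ G.IsClique (stageAux G j)) :
    (k : ℕ∞) < cornerRank G v := by
  by_cases h : cornerRank G v = ⊤
  · rw [h]
    exact ENat.natCast_lt_top k
  obtain ⟨n, hn, hP⟩ := exists_of_cornerRank_ne_top h
  rw [hn, Nat.cast_lt]
  by_contra! hlt
  rcases hP with hP | ⟨hP, -⟩
  · exact (stageAux_antitone G hlt hv).2 hP
  · exact hk n hlt hP

/-- Before the procedure stops, the remaining vertices are those of larger corner rank. -/
theorem mem_stageAux_iff {G : SimpleGraph V} {k : ℕ} {w : V} (hw : (k : ℕ∞) < cornerRank G w)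
    (v : V) : v ∈ stageAux G k ↔ (k : ℕ∞) < cornerRank G v := by
  refine ⟨fun hv => lt_cornerRank_of_mem_stageAux hv fun j hj hc => ?_, fun hv => ?_⟩
  · have hjk : ((j + 1 : ℕ) : ℕ∞) ≤ k := by exact_mod_cast hj
    refine (cornerRank_le_of_isClique hc (v := w) ?_).not_gt (hjk.trans_lt hw)
    by_contra hwj
    refine (cornerRank_le_of_notMem_stageAux hwj).not_gt (lt_of_le_of_lt ?_ hw)
    exact_mod_cast hj.le
  · by_contra hc
    exact (cornerRank_le_of_notMem_stageAux hc).not_gt hv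

/-- The vertex `i` is a strict corner of the subgraph induced on the vertices below `n`, for the
graph on `Fin 7` with adjacency function `A`. -/
def IsCornerBelow (A : Fin 7 → Fin 7 → Bool) (n : ℕ) (i : Fin 7) : Prop :=
  i.val < n ∧ ∃ w : Fin 7, w.val < n ∧ w ≠ i ∧
    (∀ u : Fin 7, u.val < n → (u = i ∨ A u i) → (u = w ∨ A u w)) ∧
    ∃ u : Fin 7, u.val < n ∧ (u = w ∨ A u w) ∧ ¬ (u = i ∨ A u i)

instance (A : Fin 7 → Fin 7 → Bool) (n : ℕ) (i : Fin 7) : Decidable (IsCornerBelow A n i) := by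
  unfold IsCornerBelow
  infer_instance

instance : DecidableRel H7.Adj := fun a b => by
  unfold H7
  simp only [SimpleGraph.fromRel_adj]
  infer_instance

/-- The adjacency function on `Fin 7` listing the pairs `(i, j)` with `j < i` row by row. -/
def adjOfList (l : List Bool) (i j : Fin 7) : Bool :=
  if j < i then l.getD (i.val * (i.val - 1) / 2 + j.val) false
  else if i < j then l.getD (j.val * (j.val - 1) / 2 + i.val) false
  else false

/-- The permutation of `Fin 7` swapping the vertices within a selection of the pairs
`{0, 1}`, `{2, 3}`, `{4, 5}`. -/
def pairSwap (p q r : Bool) : Equiv.Perm (Fin 7) :=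
  (if p then Equiv.swap 0 1 else 1) * (if q then Equiv.swap 2 3 else 1) *
    (if r then Equiv.swap 4 5 else 1)

/-- The corner ranks of the vertices of `H7`. -/
def rankH7 : Fin 7 → ℕ := ![4, 4, 3, 3, 2, 2, 1]

/-- The number of vertices of `H7` remaining after `k` stages. -/
def sizeH7 : ℕ → ℕ
  | 0 => 7
  | 1 => 6
  | 2 => 4
  | _ => 2

theorem lt_sizeH7_iff : ∀ k < 4, ∀ i, i.val < sizeH7 k ↔ k < rankH7 i := by decide

theorem adjOfList_eq_H7 :
    ∀ b0 b1 b2 b3 b4 b5 : Bool,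
    (b0 = true ∨ ∀ i : Fin 7, i.val < 2 → IsCornerBelow (adjOfList [b0]) 2 i) →
    (∀ i : Fin 7, i.val < 4 →
      (IsCornerBelow (adjOfList [b0, b1, b2, b3, b4, b5]) 4 i ↔ 2 ≤ i.val)) →
    ∀ b6 b7 b8 b9 b10 b11 b12 b13 b14 : Bool,
    (∀ i : Fin 7, i.val < 6 → (IsCornerBelow (adjOfList [b0, b1, b2, b3, b4, b5, b6, b7, b8, b9,
      b10, b11, b12, b13, b14]) 6 i ↔ 4 ≤ i.val)) →
    ∀ b15 b16 b17 b18 b19 b20 : Bool,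
    (∀ i : Fin 7, i.val < 7 → (IsCornerBelow (adjOfList [b0, b1, b2, b3, b4, b5, b6, b7, b8, b9,
      b10, b11, b12, b13, b14, b15, b16, b17, b18, b19, b20]) 7 i ↔ 6 ≤ i.val)) →
    ∃ p q r : Bool, ∀ i j : Fin 7, (adjOfList [b0, b1, b2, b3, b4, b5, b6, b7, b8, b9,
      b10, b11, b12, b13, b14, b15, b16, b17, b18, b19, b20] i j = true ↔
        H7.Adj (pairSwap p q r i) (pairSwap p q r j)) := by
  decide +kernel

theorem strictCorner_below_iff {G : SimpleGraph (Fin 7)} {A : Fin 7 → Fin 7 → Bool} {n : ℕ}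
    (h : ∀ i j : Fin 7, i.val < n → j.val < n → (A i j = true ↔ G.Adj i j)) (i : Fin 7) :
    StrictCorner G {j | j.val < n} i ↔ IsCornerBelow A n i := by
  rw [strictCorner_iff, IsCornerBelow]
  simp only [Set.mem_ofPred_eq]
  grind

theorem stageAux_H7 : ∀ k < 4, stageAux H7 k = {i | i.val < sizeH7 k} := by
  intro k
  induction k with
  | zero =>
    intro _
    ext i
    simp [stageAux, sizeH7]
  | succ k ih =>
    intro hk
    have hA : ∀ k < 3, ∀ i : Fin 7, i.val < sizeH7 (k + 1) ↔
        i.val < sizeH7 k ∧ ¬ IsCornerBelow (fun i j => decide (H7.Adj i j)) (sizeH7 k) i := by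
      decide +kernel
    ext i
    rw [stageAux, ih (by omega), Set.mem_sdiff, Set.mem_ofPred_eq, Set.mem_ofPred_eq,
      Set.mem_ofPred_eq, hA k (by omega) i,
      strictCorner_below_iff (A := fun i j => decide (H7.Adj i j)) (by simp)]

theorem cornerRank_H7 (i : Fin 7) : cornerRank H7 i = rankH7 i := by
  have hrank : ∀ i, 1 ≤ rankH7 i ∧ rankH7 i ≤ 4 := by decide
  have hmem : ∀ k < 4, (i ∈ stageAux H7 k ↔ k < rankH7 i) := fun k hk => by
    rw [stageAux_H7 k hk, Set.mem_ofPred_eq, lt_sizeH7_iff k hk]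
  obtain ⟨hpos, hle⟩ := hrank i
  apply le_antisymm
  · rcases hle.lt_or_eq with hlt | heq
    · exact cornerRank_le_of_notMem_stageAux (by simp [hmem _ hlt])
    · rw [heq]
      refine cornerRank_le_of_isClique (k := 3) ?_ ((hmem 3 (by norm_num)).2 (by omega))
      rw [stageAux_H7 3 (by norm_num)]
      have : ∀ a b : Fin 7, a.val < sizeH7 3 → b.val < sizeH7 3 → a ≠ b → H7.Adj a b := by
        decide
      exact fun a ha b hb => this a b ha hb
  · obtain ⟨k, hk⟩ := Nat.exists_eq_add_of_le' hpos
    have hlt : (k : ℕ∞) < cornerRank H7 i := by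
      refine lt_cornerRank_of_mem_stageAux ((hmem k (by omega)).2 (by omega)) fun j hj hc => ?_
      rw [stageAux_H7 j (by omega)] at hc
      have : ∀ j < 3, ∃ a b : Fin 7, a.val < sizeH7 j ∧ b.val < sizeH7 j ∧ a ≠ b ∧
          ¬ H7.Adj a b := by
        decide
      obtain ⟨a, b, ha, hb, hab, hn⟩ := this j (by omega)
      exact hn (hc ha hb hab)
    rw [hk]
    exact_mod_cast Order.add_one_le_of_lt hlt

theorem realizes_H7 : Realizes H7 [2, 2, 2, 1] := by
  refine ⟨fun v => ?_, ?_, ?_⟩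
  · rw [cornerRank_H7]
    exact ENat.natCast_ne_top _
  · have hle : ∀ i, rankH7 i ≤ 4 := by decide
    simp only [graphRank, cornerRank_H7]
    refine le_antisymm (iSup_le fun i => ?_) (le_iSup_of_le 0 le_rfl)
    exact_mod_cast hle i
  · simp only [cornerRank_H7, Nat.cast_inj]
    intro i
    rw [Set.ncard_eq_toFinset_card']
    revert i
    simp only [Set.toFinset_ofPred]
    decide

/-- The vertices of a realization of `(2, 2, 2, 1)` can be labelled so that the corner ranks are
those of `H7`. -/
theorem exists_equiv_of_realizes {W : Type*} {G : SimpleGraph W} (h : Realizes G [2, 2, 2, 1]) :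
    ∃ e : Fin 7 ≃ W, ∀ i, cornerRank G (e i) = rankH7 i := by
  obtain ⟨hcop, hrank, hcard⟩ := h
  have h4 : {v | cornerRank G v = (4 : ℕ)}.ncard = 2 := (hcard 0).symm
  have h3 : {v | cornerRank G v = (3 : ℕ)}.ncard = 2 := (hcard 1).symm
  have h2 : {v | cornerRank G v = (2 : ℕ)}.ncard = 2 := (hcard 2).symm
  have h1 : {v | cornerRank G v = (1 : ℕ)}.ncard = 1 := (hcard 3).symm
  obtain ⟨a, a', ha, h4⟩ := Set.ncard_eq_two.1 h4
  obtain ⟨b, b', hb, h3⟩ := Set.ncard_eq_two.1 h3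
  obtain ⟨c, c', hc, h2⟩ := Set.ncard_eq_two.1 h2
  obtain ⟨d, h1⟩ := Set.ncard_eq_one.1 h1
  simp only [Set.ext_iff, Set.mem_ofPred_eq, Set.mem_insert_iff, Set.mem_singleton_iff]
    at h1 h2 h3 h4
  have hf : ∀ i, cornerRank G (![a, a', b, b', c, c', d] i) = rankH7 i := by
    intro i
    fin_cases i
    · exact (h4 a).2 (Or.inl rfl)
    · exact (h4 a').2 (Or.inr rfl)
    · exact (h3 b).2 (Or.inl rfl)
    · exact (h3 b').2 (Or.inr rfl)
    · exact (h2 c).2 (Or.inl rfl)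
    · exact (h2 c').2 (Or.inr rfl)
    · exact (h1 d).2 rfl
  refine ⟨Equiv.ofBijective ![a, a', b, b', c, c', d] ⟨fun i j hij => ?_, fun v => ?_⟩, hf⟩
  · have hr : rankH7 i = rankH7 j := by
      have := (hf i).symm.trans ((congrArg _ hij).trans (hf j))
      exact_mod_cast this
    have hcases : ∀ i j, rankH7 i = rankH7 j → i = j ∨ (i = 0 ∧ j = 1) ∨ (i = 1 ∧ j = 0) ∨
        (i = 2 ∧ j = 3) ∨ (i = 3 ∧ j = 2) ∨ (i = 4 ∧ j = 5) ∨ (i = 5 ∧ j = 4) := by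
      decide
    rcases hcases i j hr with h | ⟨rfl, rfl⟩ | ⟨rfl, rfl⟩ | ⟨rfl, rfl⟩ | ⟨rfl, rfl⟩ |
      ⟨rfl, rfl⟩ | ⟨rfl, rfl⟩
    · exact h
    · exact absurd hij ha
    · exact absurd hij.symm ha
    · exact absurd hij hb
    · exact absurd hij.symm hb
    · exact absurd hij hc
    · exact absurd hij.symm hc
  · obtain ⟨k, hk, -⟩ := exists_of_cornerRank_ne_top (hcop v)
    have hle : cornerRank G v ≤ (4 : ℕ) := (le_iSup (cornerRank G) v).trans hrank.le
    rw [hk, Nat.cast_le] at hle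
    have hk4 : k < 4 := by omega
    interval_cases k
    · exact ⟨6, ((h1 v).1 hk).symm⟩
    · rcases (h2 v).1 hk with h | h
      exacts [⟨4, h.symm⟩, ⟨5, h.symm⟩]
    · rcases (h3 v).1 hk with h | h
      exacts [⟨2, h.symm⟩, ⟨3, h.symm⟩]
    · rcases (h4 v).1 hk with h | h
      exacts [⟨0, h.symm⟩, ⟨1, h.symm⟩]

theorem nonempty_iso_H7_of_isCornerBelow {G : SimpleGraph (Fin 7)}
    (hclique : G.Adj 1 0 ∨ ∀ i : Fin 7, i.val < 2 → StrictCorner G {j | j.val < 2} i)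
    (hcorner : ∀ k < 3, ∀ i : Fin 7, i.val < sizeH7 k →
      (StrictCorner G {j | j.val < sizeH7 k} i ↔ sizeH7 (k + 1) ≤ i.val)) :
    Nonempty (G ≃g H7) := by
  classical
  let A (i j : Fin 7) : Bool := decide (G.Adj i j)
  have agree : ∀ n (l : List Bool), (∀ i j : Fin 7, j < i → i.val < n →
      l.getD (i.val * (i.val - 1) / 2 + j.val) false = A i j) →
      ∀ i j : Fin 7, i.val < n → j.val < n → (adjOfList l i j = true ↔ G.Adj i j) := by
    intro n l hl i j hi hj
    rcases lt_trichotomy i j with hij | rfl | hij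
    · rw [adjOfList, if_neg hij.not_gt, if_pos hij, hl j i hij hj, decide_eq_true_iff, G.adj_comm]
    · simp [adjOfList]
    · rw [adjOfList, if_pos hij, hl i j hij hi, decide_eq_true_iff]
  have agree7 := agree 7 [A 1 0, A 2 0, A 2 1, A 3 0, A 3 1, A 3 2, A 4 0, A 4 1, A 4 2, A 4 3,
    A 5 0, A 5 1, A 5 2, A 5 3, A 5 4, A 6 0, A 6 1, A 6 2, A 6 3, A 6 4, A 6 5]
    (by intro i j hij hi; fin_cases i <;> fin_cases j <;>
      first | rfl | exact absurd hij (by decide))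
  have agree6 := agree 6 [A 1 0, A 2 0, A 2 1, A 3 0, A 3 1, A 3 2, A 4 0, A 4 1, A 4 2, A 4 3,
    A 5 0, A 5 1, A 5 2, A 5 3, A 5 4]
    (by intro i j hij hi; fin_cases i <;> fin_cases j <;>
      first | rfl | exact absurd hij (by decide) | exact absurd hi (by decide))
  have agree4 := agree 4 [A 1 0, A 2 0, A 2 1, A 3 0, A 3 1, A 3 2]
    (by intro i j hij hi; fin_cases i <;> fin_cases j <;>
      first | rfl | exact absurd hij (by decide) | exact absurd hi (by decide))
  have agree2 := agree 2 [A 1 0]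
    (by intro i j hij hi; fin_cases i <;> fin_cases j <;>
      first | rfl | exact absurd hij (by decide) | exact absurd hi (by decide))
  obtain ⟨p, q, r, hpqr⟩ := adjOfList_eq_H7 _ _ _ _ _ _
    (hclique.imp (by simp [A]) fun h i hi => (strictCorner_below_iff agree2 i).1 (h i hi))
    (fun i hi => (strictCorner_below_iff agree4 i).symm.trans (hcorner 2 (by norm_num) i hi))
    _ _ _ _ _ _ _ _ _
    (fun i hi => (strictCorner_below_iff agree6 i).symm.trans (hcorner 1 (by norm_num) i hi))
    _ _ _ _ _ _
    (fun i hi => (strictCorner_below_iff agree7 i).symm.trans (hcorner 0 (by norm_num) i hi))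
  exact ⟨⟨pairSwap p q r, fun {i j} => (hpqr i j).symm.trans (agree7 i j i.isLt j.isLt)⟩⟩

theorem nonempty_iso_H7_of_realizes {W : Type*} {G : SimpleGraph W}
    (h : Realizes G [2, 2, 2, 1]) : Nonempty (G ≃g H7) := by
  obtain ⟨e, he⟩ := exists_equiv_of_realizes h
  have hpre : ∀ k < 4, e ⁻¹' stageAux G k = {i | i.val < sizeH7 k} := by
    intro k hk
    ext i
    have hw : (k : ℕ∞) < cornerRank G (e 0) := by
      rw [he]
      exact_mod_cast hk
    rw [Set.mem_preimage, mem_stageAux_iff hw, he, Set.mem_ofPred_eq, lt_sizeH7_iff k hk,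
      Nat.cast_lt]
  have hcorner : ∀ k < 4, ∀ i, StrictCorner (G.comap e) {i | i.val < sizeH7 k} i ↔
      StrictCorner G (stageAux G k) (e i) := by
    intro k hk i
    rw [← hpre k hk, strictCorner_preimage]
  obtain ⟨f⟩ : Nonempty (G.comap e ≃g H7) := by
    refine nonempty_iso_H7_of_isCornerBelow ?_ fun k hk i hi => ?_
    · by_cases hadj : G.Adj (e 1) (e 0)
      · exact Or.inl hadj
      · refine Or.inr fun i hi => (hcorner 3 (by norm_num) i).2 ?_
        obtain ⟨k, hk, hP⟩ := exists_of_cornerRank_ne_top (h.1 (e i))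
        have hri : rankH7 i = k + 1 := by exact_mod_cast (he i).symm.trans hk
        have hr : ∀ i : Fin 7, i.val < 2 → rankH7 i = 4 := by decide
        obtain rfl : k = 3 := by have := hr i hi; omega
        refine hP.resolve_right fun hc => hadj (hc.1 ?_ ?_ (e.injective.ne (by decide)))
        · exact (Set.ext_iff.1 (hpre 3 (by norm_num)) 1).2 (by decide)
        · exact (Set.ext_iff.1 (hpre 3 (by norm_num)) 0).2 (by decide)
    · rw [hcorner k (by omega)]
      have hk0 : e i ∈ stageAux G k := (Set.ext_iff.1 (hpre k (by omega)) i).2 hi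
      have hk1 : e i ∈ stageAux G (k + 1) ↔ i.val < sizeH7 (k + 1) :=
        Set.ext_iff.1 (hpre (k + 1) (by omega)) i
      rw [← not_lt, ← hk1, stageAux, Set.mem_sdiff, Set.mem_ofPred_eq]
      tauto
  exact ⟨(SimpleGraph.Iso.comap e G).symm.trans f⟩

/-- the vector `(2, 2, 2, 1)` is uniquely realized by `H₇`. -/
theorem H7_uniquely_realizes_2221 :
    CopsRobbers.Realizes H7 [2, 2, 2, 1] ∧
    ∀ (W : Type) (_ : Fintype W) (G : SimpleGraph W),
      CopsRobbers.Realizes G [2, 2, 2, 1] → Nonempty (G ≃g H7) := by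
  exact ⟨realizes_H7, fun _ _ _ h => nonempty_iso_H7_of_realizes h⟩

end CopsRobbers
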